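/- arXiv:2003.06826 — 7 statements merged into one kernel-verified Lean document; each statement's English description precedes it below -/
import Mathlib

section
/- Let r be a finite set of coins, ε ≥ 0 a real number, L : r → ℝ a likelihood function with L(c) > 0 for every c ∈ r (L(c) models the probability Pr(r | c) that coin c, if spent, is spent in r), and π : r → ℝ a prior with π(c) ≥ 0 for every c ∈ r and Σ_{c ∈ r} π(c)·L(c) > 0. Define the posterior Pr(c | r) = π(c)·L(c) / Σ_{c' ∈ r} π(c')·L(c'). If r satisfies ε-coin-indistinguishability, i.e., L(c) ≤ e^ε · L(c') for all c, c' ∈ r, then for every c ∈ r: Pr(c | r) ≤ e^ε · π(c) / Σ_{c' ∈ r} π(c'). -/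
/-- Bounded information leakage: if the ring signature `r` satisfies
`ε`-coin-indistinguishability, i.e. `L c ≤ exp ε * L c'` for all coins
`c, c' ∈ r`, then the Bayesian posterior `π c * L c / ∑ c' ∈ r, π c' * L c'`
of any coin `c ∈ r` being the coin spent in `r` is at most
`exp ε * π c / ∑ c' ∈ r, π c'`. -/
theorem stmt0 {C : Type*} [DecidableEq C] (r : Finset C) (ε : ℝ) (hε : 0 ≤ ε)
    (L : C → ℝ) (π : C → ℝ)
    (hL : ∀ c ∈ r, 0 < L c)
    (hπ : ∀ c ∈ r, 0 ≤ π c)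
    (hsum : 0 < ∑ c ∈ r, π c * L c)
    (hCI : ∀ c ∈ r, ∀ c' ∈ r, L c ≤ Real.exp ε * L c') :
    ∀ c ∈ r,
      π c * L c / (∑ c' ∈ r, π c' * L c') ≤
        Real.exp ε * π c / (∑ c' ∈ r, π c') := by
  intro c hc
  have hpos : 0 < ∑ c' ∈ r, π c' := by
    refine (Finset.sum_nonneg hπ).lt_of_ne' fun h0 => hsum.ne' ?_
    have hzero := (Finset.sum_eq_zero_iff_of_nonneg hπ).1 h0
    exact Finset.sum_eq_zero fun x hx => by rw [hzero x hx, zero_mul]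
  have key : L c * ∑ c' ∈ r, π c' ≤ Real.exp ε * ∑ c' ∈ r, π c' * L c' := by
    rw [Finset.mul_sum, Finset.mul_sum]
    refine Finset.sum_le_sum fun x hx => ?_
    linarith [mul_le_mul_of_nonneg_left (hCI c hc x hx) (hπ x hx)]
  rw [div_le_div_iff₀ hsum hpos]
  linarith [mul_le_mul_of_nonneg_left key (hπ c hc)]
end

section
/- Assume the sequence R_1, …, R_m is disjoint-superset and d_i ≥ 1 for every i. Then for every i with 2 ≤ i ≤ m, every j < i, and every coin c ∈ R_j: Pr_i(c, r_j) = Pr_{i−1}(c, r_j). -/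
open scoped Classical

/-- The spent coin permutations for the first `k` ring signatures of the
sequence `R` (rings are indexed from `1`): injective functions `σ : Fin k → C`
with `σ(j) ∈ R_j` for each `j ∈ {1, …, k}` (position `j` of `σ` is `j - 1`). -/
noncomputable def perms {C : Type*} [Fintype C] [DecidableEq C]
    (R : ℕ → Finset C) (k : ℕ) : Finset (Fin k → C) :=
  Finset.univ.filter fun σ => Function.Injective σ ∧ ∀ j : Fin k, σ j ∈ R (j.1 + 1)

/-- `N_k`, the number of spent coin permutations for the first `k` ring signatures. -/
noncomputable def numPerms {C : Type*} [Fintype C] [DecidableEq C]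
    (R : ℕ → Finset C) (k : ℕ) : ℕ :=
  (perms R k).card

/-- `Pr_k(c, r_j)`: the fraction of spent coin permutations `σ` for the first `k`
ring signatures with `σ(j) = c`. -/
noncomputable def prSpentIn {C : Type*} [Fintype C] [DecidableEq C]
    (R : ℕ → Finset C) (k j : ℕ) (c : C) : ℝ :=
  (((perms R k).filter fun σ => ∃ h : j - 1 < k, σ ⟨j - 1, h⟩ = c).card : ℝ) /
    (numPerms R k : ℝ)

/-- `Pr_k(c)`: the fraction of spent coin permutations `σ` for the first `k`
ring signatures having `c` in their image. -/
noncomputable def prSpent {C : Type*} [Fintype C] [DecidableEq C]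
    (R : ℕ → Finset C) (k : ℕ) (c : C) : ℝ :=
  (((perms R k).filter fun σ => ∃ j, σ j = c).card : ℝ) / (numPerms R k : ℝ)

/-- `Pr_k(r_j | c) = Pr_k(c, r_j) / Pr_k(c)`. -/
noncomputable def prCond {C : Type*} [Fintype C] [DecidableEq C]
    (R : ℕ → Finset C) (k j : ℕ) (c : C) : ℝ :=
  prSpentIn R k j c / prSpent R k c

/-- The first `m` ring signatures of `R` are disjoint-superset: for all
`1 ≤ j < i ≤ m`, either `R_i ∩ R_j = ∅` or `R_j ⊆ R_i`. -/
def DisjointSuperset {C : Type*} [Fintype C] [DecidableEq C]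
    (R : ℕ → Finset C) (m : ℕ) : Prop :=
  ∀ i j, 1 ≤ j → j < i → i ≤ m → Disjoint (R i) (R j) ∨ R j ⊆ R i

/-- `ns_i`: the number of indices `j < i` with `R_j ⊆ R_i`. -/
noncomputable def nsub {C : Type*} [Fintype C] [DecidableEq C]
    (R : ℕ → Finset C) (i : ℕ) : ℕ :=
  ((Finset.Ico 1 i).filter fun j => R j ⊆ R i).card

/-- The degree `d_i = |R_i| - ns_i`. -/
noncomputable def deg {C : Type*} [Fintype C] [DecidableEq C]
    (R : ℕ → Finset C) (i : ℕ) : ℕ :=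
  (R i).card - nsub R i

lemma snoc_mem_perms {C : Type*} [Fintype C] [DecidableEq C]
    (R : ℕ → Finset C) (k : ℕ) (τ : Fin k → C) (x : C) :
    (Fin.snoc τ x : Fin (k + 1) → C) ∈ perms R (k + 1) ↔
      τ ∈ perms R k ∧ x ∈ R (k + 1) \ Finset.univ.image τ := by
  simp only [perms, Finset.mem_filter, Finset.mem_univ, true_and, Fin.snoc_injective_iff,
    Fin.forall_fin_succ', Fin.snoc_castSucc, Fin.snoc_last, Fin.val_castSucc, Fin.val_last,
    Finset.mem_sdiff, Finset.mem_image, Set.mem_range]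
  tauto

lemma card_inter_image_eq_nsub {C : Type*} [Fintype C] [DecidableEq C]
    (R : ℕ → Finset C) (m k : ℕ) (hds : DisjointSuperset R m) (hk : k + 1 ≤ m)
    (τ : Fin k → C) (hτ : τ ∈ perms R k) :
    (Finset.univ.image τ ∩ R (k + 1)).card = nsub R (k + 1) := by
  simp only [perms, Finset.mem_filter, Finset.mem_univ, true_and] at hτ
  have key (j : Fin k) : τ j ∈ R (k + 1) ↔ R (j.1 + 1) ⊆ R (k + 1) := by
    refine ⟨fun h => ?_, fun h => h (hτ.2 j)⟩
    exact (hds (k + 1) (j.1 + 1) (by omega) (by omega) hk).resolve_left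
      fun hd => Finset.disjoint_left.1 hd h (hτ.2 j)
  symm
  unfold nsub
  refine Finset.card_bij
    (fun j hj => τ ⟨j - 1, by simp only [Finset.mem_filter, Finset.mem_Ico] at hj; omega⟩)
    ?_ ?_ ?_
  · intro j hj
    simp only [Finset.mem_filter, Finset.mem_Ico] at hj
    refine Finset.mem_inter.2 ⟨Finset.mem_image_of_mem _ (Finset.mem_univ _), (key _).2 ?_⟩
    simpa [Nat.sub_add_cancel hj.1.1] using hj.2
  · intro i hi j hj h
    simp only [Finset.mem_filter, Finset.mem_Ico] at hi hj
    have := congrArg Fin.val (hτ.1 h)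
    simp only at this
    omega
  · intro x hx
    obtain ⟨hx, hR⟩ := Finset.mem_inter.1 hx
    obtain ⟨j, -, rfl⟩ := Finset.mem_image.1 hx
    refine ⟨j.1 + 1, ?_, rfl⟩
    simp only [Finset.mem_filter, Finset.mem_Ico]
    exact ⟨by omega, (key j).1 hR⟩

/-- Every spent coin permutation for the first `k` ring signatures extends to exactly
`deg R (k + 1)` spent coin permutations for the first `k + 1` ring signatures. -/
lemma card_perms_succ_filter {C : Type*} [Fintype C] [DecidableEq C]
    (R : ℕ → Finset C) (m k : ℕ) (hds : DisjointSuperset R m) (hk : k + 1 ≤ m)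
    (P : (Fin k → C) → Prop) [DecidablePred P] :
    ((perms R (k + 1)).filter fun σ => P (Fin.init σ)).card =
      deg R (k + 1) * ((perms R k).filter P).card := by
  have hfiber : ∀ τ ∈ (perms R k).filter P,
      (R (k + 1) \ Finset.univ.image τ).card = deg R (k + 1) := fun τ hτ => by
    rw [Finset.card_sdiff,
      card_inter_image_eq_nsub R m k hds hk τ (Finset.mem_filter.1 hτ).1, deg]
  rw [mul_comm, ← smul_eq_mul, ← Finset.sum_const, ← Finset.sum_congr rfl hfiber,
    ← Finset.card_sigma]
  symm
  refine Finset.card_bij' (fun p _ => (Fin.snoc p.1 p.2 : Fin (k + 1) → C))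
    (fun σ _ => ⟨Fin.init σ, σ (Fin.last k)⟩) ?_ ?_ ?_ ?_
  · rintro ⟨τ, x⟩ h
    simp only [Finset.mem_sigma, Finset.mem_filter] at h
    simp only [Finset.mem_filter, snoc_mem_perms, Fin.init_snoc]
    exact ⟨⟨h.1.1, h.2⟩, h.1.2⟩
  · intro σ h
    obtain ⟨h, hP⟩ := Finset.mem_filter.1 h
    rw [← Fin.snoc_init_self σ, snoc_mem_perms] at h
    simp only [Finset.mem_sigma, Finset.mem_filter]
    exact ⟨⟨h.1, hP⟩, h.2⟩
  · rintro ⟨τ, x⟩ _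
    simp
  · intro σ _
    simp

theorem stmt1 {C : Type*} [Fintype C] [DecidableEq C]
    (R : ℕ → Finset C) (m : ℕ)
    (hne : ∀ i, 1 ≤ i → i ≤ m → (R i).Nonempty)
    (hds : DisjointSuperset R m)
    (hdeg : ∀ i, 1 ≤ i → i ≤ m → 1 ≤ deg R i) :
    ∀ i, 2 ≤ i → i ≤ m → ∀ j, 1 ≤ j → j < i → ∀ c ∈ R j,
      prSpentIn R i j c = prSpentIn R (i - 1) j c := by
  intro i hi him j hj hji c _
  obtain ⟨k, rfl⟩ : ∃ k, i = k + 1 := ⟨i - 1, by omega⟩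
  have hd : (deg R (k + 1) : ℝ) ≠ 0 := by
    exact_mod_cast Nat.one_le_iff_ne_zero.1 (hdeg (k + 1) (by omega) him)
  have hnum := card_perms_succ_filter R m k hds him fun τ => ∃ h : j - 1 < k, τ ⟨j - 1, h⟩ = c
  have hden : numPerms R (k + 1) = deg R (k + 1) * numPerms R k := by
    simpa [numPerms] using card_perms_succ_filter R m k hds him fun _ => True
  have hfilter : ((perms R (k + 1)).filter fun σ => ∃ h : j - 1 < k + 1, σ ⟨j - 1, h⟩ = c) =
      (perms R (k + 1)).filter fun σ => ∃ h : j - 1 < k, (Fin.init σ : Fin k → C) ⟨j - 1, h⟩ = c :=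
    Finset.filter_congr fun σ _ =>
      ⟨fun ⟨_, h⟩ => ⟨by omega, h⟩, fun ⟨_, h⟩ => ⟨by omega, h⟩⟩
  unfold prSpentIn
  rw [hfilter, hnum, hden, Nat.add_sub_cancel]
  push_cast
  exact mul_div_mul_left _ _ hd
end

section
/- Assume the sequence R_1, …, R_m is disjoint-superset and d_i ≥ 1 for every i. Then for every f with 1 ≤ f ≤ m and every coin c ∈ R_f: Pr_f(c, r_f) = (1 − Pr_{f−1}(c)) / d_f. -/
open scoped Classical

theorem mem_perms {C : Type*} [Fintype C] [DecidableEq C] {R : ℕ → Finset C} {k : ℕ}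
    {σ : Fin k → C} :
    σ ∈ perms R k ↔ Function.Injective σ ∧ ∀ j : Fin k, σ j ∈ R (j.1 + 1) := by
  simp [perms]

/-- Dropping the last entry matches the permutations ending in `c` with the shorter
permutations avoiding `c`. -/
theorem card_perms_last_eq {C : Type*} [Fintype C] [DecidableEq C] (R : ℕ → Finset C) (k : ℕ)
    {c : C} (hc : c ∈ R (k + 1)) :
    ((perms R (k + 1)).filter fun σ => σ (Fin.last k) = c).card =
      ((perms R k).filter fun σ => ¬ ∃ j, σ j = c).card := by
  symm
  refine Finset.card_bij (fun σ _ => (Fin.snoc σ c : Fin (k + 1) → C)) ?_ ?_ ?_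
  · intro σ hσ
    rw [Finset.mem_filter, mem_perms] at hσ ⊢
    obtain ⟨⟨hinj, hmem⟩, hnot⟩ := hσ
    refine ⟨⟨Fin.snoc_injective_iff.2 ⟨hinj, hnot⟩, fun j => ?_⟩, by simp⟩
    induction j using Fin.lastCases with
    | last => simpa using hc
    | cast j => simpa using hmem j
  · intro σ _ τ _ h
    have := congrArg Fin.init h
    simpa using this
  · intro τ hτ
    rw [Finset.mem_filter, mem_perms] at hτ
    obtain ⟨⟨hinj, hmem⟩, hlast⟩ := hτ
    refine ⟨Fin.init τ, ?_, ?_⟩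
    · rw [Finset.mem_filter, mem_perms]
      refine ⟨⟨fun i j h => ?_, fun j => ?_⟩, ?_⟩
      · exact Fin.castSucc_injective k (hinj h)
      · exact hmem j.castSucc
      · rintro ⟨j, hj⟩
        exact (Fin.castSucc_lt_last j).ne (hinj (hj.trans hlast.symm))
    · rw [← hlast]
      exact Fin.snoc_init_self τ

/-- In a disjoint-superset sequence, every spent coin permutation for the first `k` ring
signatures leaves exactly `deg R (k + 1)` coins of the next one unspent. -/
theorem card_unspent_eq_deg {C : Type*} [Fintype C] [DecidableEq C] {R : ℕ → Finset C}
    {m k : ℕ} (hds : DisjointSuperset R m) (hk : k + 1 ≤ m) {σ : Fin k → C}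
    (hσ : σ ∈ perms R k) :
    ((R (k + 1)).filter fun c => ¬ ∃ j, σ j = c).card = deg R (k + 1) := by
  obtain ⟨hinj, hmem⟩ := mem_perms.1 hσ
  have hsub : ∀ j : Fin k, σ j ∈ R (k + 1) ↔ R (j.1 + 1) ⊆ R (k + 1) := by
    intro j
    refine ⟨fun h => ?_, fun h => h (hmem j)⟩
    refine (hds (k + 1) (j.1 + 1) (by omega) (by omega) hk).resolve_left fun hd => ?_
    exact Finset.disjoint_left.1 hd h (hmem j)
  have hspent : ((R (k + 1)).filter fun c => ∃ j, σ j = c).card = nsub R (k + 1) := by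
    trans (Finset.univ.filter fun j : Fin k => R (j.1 + 1) ⊆ R (k + 1)).card
    · symm
      refine Finset.card_bij (fun j _ => σ j) ?_ (fun i _ j _ h => hinj h) ?_
      · intro j hj
        simp only [Finset.mem_filter, Finset.mem_univ, true_and] at hj
        simp [(hsub j).2 hj]
      · intro c hc
        obtain ⟨hcR, j, rfl⟩ := Finset.mem_filter.1 hc
        exact ⟨j, by simpa using (hsub j).1 hcR, rfl⟩
    · refine Finset.card_bij (fun j _ => j.1 + 1) ?_ (fun i _ j _ h => ?_) ?_
      · intro j hj
        simpa using hj
      · exact Fin.ext (Nat.succ_injective h)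
      · intro i hi
        simp only [Finset.mem_filter, Finset.mem_Ico] at hi
        obtain ⟨⟨h1, h2⟩, h3⟩ := hi
        have hi' : i - 1 + 1 = i := by omega
        exact ⟨⟨i - 1, by omega⟩, by simpa [hi'] using h3, hi'⟩
  have hsplit := Finset.card_filter_add_card_filter_not (s := R (k + 1)) fun c => ∃ j, σ j = c
  unfold deg
  omega

theorem numPerms_succ {C : Type*} [Fintype C] [DecidableEq C] {R : ℕ → Finset C}
    {m k : ℕ} (hds : DisjointSuperset R m) (hk : k + 1 ≤ m) :
    numPerms R (k + 1) = numPerms R k * deg R (k + 1) := by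
  have hmaps : ∀ σ ∈ perms R (k + 1), σ (Fin.last k) ∈ R (k + 1) :=
    fun σ hσ => (mem_perms.1 hσ).2 (Fin.last k)
  calc numPerms R (k + 1)
      = ∑ c ∈ R (k + 1), ((perms R (k + 1)).filter fun σ => σ (Fin.last k) = c).card := by
        rw [numPerms, Finset.card_eq_sum_card_fiberwise hmaps]
    _ = ∑ c ∈ R (k + 1), ((perms R k).filter fun σ => ¬ ∃ j, σ j = c).card :=
        Finset.sum_congr rfl fun c hc => card_perms_last_eq R k hc
    _ = ∑ σ ∈ perms R k, ((R (k + 1)).filter fun c => ¬ ∃ j, σ j = c).card :=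
        (Finset.sum_card_bipartiteAbove_eq_sum_card_bipartiteBelow
          fun (σ : Fin k → C) c => ¬ ∃ j, σ j = c).symm
    _ = ∑ _σ ∈ perms R k, deg R (k + 1) :=
        Finset.sum_congr rfl fun σ hσ => card_unspent_eq_deg hds hk hσ
    _ = numPerms R k * deg R (k + 1) := by simp [numPerms]

theorem numPerms_pos {C : Type*} [Fintype C] [DecidableEq C] {R : ℕ → Finset C} {m : ℕ}
    (hds : DisjointSuperset R m) (hdeg : ∀ i, 1 ≤ i → i ≤ m → 1 ≤ deg R i) :
    ∀ {k : ℕ}, k ≤ m → 0 < numPerms R k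
  | 0, _ => Finset.card_pos.2
      ⟨Fin.elim0, mem_perms.2 ⟨Function.injective_of_subsingleton _, fun j => j.elim0⟩⟩
  | k + 1, hk => by
      rw [numPerms_succ hds hk]
      exact Nat.mul_pos (numPerms_pos hds hdeg (by omega)) (hdeg (k + 1) (by omega) hk)

theorem stmt2 {C : Type*} [Fintype C] [DecidableEq C]
    (R : ℕ → Finset C) (m : ℕ)
    (hne : ∀ i, 1 ≤ i → i ≤ m → (R i).Nonempty)
    (hds : DisjointSuperset R m)
    (hdeg : ∀ i, 1 ≤ i → i ≤ m → 1 ≤ deg R i) :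
    ∀ f, 1 ≤ f → f ≤ m → ∀ c ∈ R f,
      prSpentIn R f f c = (1 - prSpent R (f - 1) c) / (deg R f : ℝ) := by
  intro f hf hfm c hc
  obtain ⟨k, rfl⟩ : ∃ k, f = k + 1 := ⟨f - 1, by omega⟩
  have hpos : (numPerms R k : ℝ) ≠ 0 := by
    exact_mod_cast (numPerms_pos hds hdeg (k := k) (by omega)).ne'
  have hd : (deg R (k + 1) : ℝ) ≠ 0 := by
    have := hdeg (k + 1) hf hfm
    exact_mod_cast (by omega : deg R (k + 1) ≠ 0)
  have hlast : ((perms R (k + 1)).filter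
      fun σ => ∃ h : k + 1 - 1 < k + 1, σ ⟨k + 1 - 1, h⟩ = c).card =
      ((perms R k).filter fun σ => ¬ ∃ j, σ j = c).card := by
    rw [← card_perms_last_eq R k hc]
    congr 1
    ext σ
    simp [Fin.last]
  have hsplit : (((perms R k).filter fun σ => ∃ j, σ j = c).card : ℝ) +
      ((perms R k).filter fun σ => ¬ ∃ j, σ j = c).card = numPerms R k := by
    exact_mod_cast Finset.card_filter_add_card_filter_not (s := perms R k) fun σ => ∃ j, σ j = c
  rw [prSpentIn, prSpent, hlast, numPerms_succ hds hfm, Nat.add_sub_cancel]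
  push_cast
  field_simp
  linarith
end

section
/- Let R be a finite collection of nonempty finite sets of coins (the existing ring signatures), let S_1, …, S_k be pairwise disjoint finite sets of coins (the selected super ring signatures), and let F be a finite set of coins (the selected fresh coins) disjoint from every S_t and contained in no member of R. Let r_τ = F ∪ S_1 ∪ … ∪ S_k, and assume that every r ∈ R that intersects r_τ satisfies r ⊆ S_t for some t. For each t let ns_t = #{r ∈ R : r ⊆ S_t} and d_t = |S_t| − ns_t. Then the degree of r_τ, namely |r_τ| − #{r ∈ R : r ⊆ r_τ}, equals Σ_{t=1}^{k} d_t + |F|. -/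
open scoped Classical

/-- The degree of the new ring signature `r_τ = F ∪ S_1 ∪ ⋯ ∪ S_k` (built from
pairwise disjoint selected super ring signatures `S_t` and fresh coins `F`)
equals `∑ t, d_t + |F|`, where `d_t = |S_t| - ns_t` and
`ns_t = #{r ∈ R : r ⊆ S_t}`. -/
theorem stmt7 {C : Type*} [DecidableEq C] (R : Finset (Finset C))
    (hR : ∀ r ∈ R, r.Nonempty)
    (k : ℕ) (S : Fin k → Finset C)
    (hS : ∀ t t', t ≠ t' → Disjoint (S t) (S t'))
    (F : Finset C)
    (hFS : ∀ t, Disjoint F (S t))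
    (hF : ∀ c ∈ F, ∀ r ∈ R, c ∉ r)
    (rτ : Finset C) (hrτ : rτ = F ∪ Finset.univ.biUnion S)
    (hcover : ∀ r ∈ R, (r ∩ rτ).Nonempty → ∃ t, r ⊆ S t) :
    (rτ.card : ℤ) - ((R.filter fun r => r ⊆ rτ).card : ℤ) =
      (∑ t : Fin k, (((S t).card : ℤ) - ((R.filter fun r => r ⊆ S t).card : ℤ)))
        + (F.card : ℤ) := by
  have subset_rτ (t : Fin k) : S t ⊆ rτ := by
    rw [hrτ]
    exact (Finset.subset_biUnion_of_mem S (Finset.mem_univ t)).trans Finset.subset_union_right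
  have card_rτ : rτ.card = F.card + ∑ t, (S t).card := by
    rw [hrτ, Finset.card_union_of_disjoint ((Finset.disjoint_biUnion_right _ _ _).2 fun t _ => hFS t),
      Finset.card_biUnion fun t _ t' _ h => hS t t' h]
  have filter_rτ : (R.filter fun r => r ⊆ rτ) =
      Finset.univ.biUnion fun t => R.filter fun r => r ⊆ S t := by
    ext r
    simp only [Finset.mem_filter, Finset.mem_biUnion, Finset.mem_univ, true_and]
    constructor
    · rintro ⟨hr, hsub⟩
      obtain ⟨t, ht⟩ := hcover r hr (by rw [Finset.inter_eq_left.2 hsub]; exact hR r hr)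
      exact ⟨t, hr, ht⟩
    · rintro ⟨t, hr, ht⟩
      exact ⟨hr, ht.trans (subset_rτ t)⟩
  have card_filter_rτ : (R.filter fun r => r ⊆ rτ).card =
      ∑ t, (R.filter fun r => r ⊆ S t).card := by
    rw [filter_rτ, Finset.card_biUnion]
    intro t _ t' _ h
    refine Finset.disjoint_left.2 ?_
    intro r hr hr'
    rw [Finset.mem_filter] at hr hr'
    obtain ⟨c, hc⟩ := hR r hr.1
    exact Finset.disjoint_left.1 (hS t t' h) (hr.2 hc) (hr'.2 hc)
  rw [card_rτ, card_filter_rτ, Finset.sum_sub_distrib]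
  push_cast
  ring
end

section
/- Let ε ≥ 0 and d ≥ 1 be real numbers and let 0 ≤ p_min ≤ p_max ≤ 1 be real numbers. Set X = e^ε · p_min · (1 − p_max) − p_max · (1 − p_min) and Y = (e^ε − 1) · (1 − p_max) · (p_min − 1). If X ≥ 0, or if X < 0 and d ≤ Y / X, then e^ε · (1 − p_max) · ((d − 1)·p_min + 1) ≥ (1 − p_min) · ((d − 1)·p_max + 1). -/
/-- If `X ≥ 0`, or `X < 0` and `d ≤ Y / X`, then the new ring signature of
degree `d` with maximal/minimal coin spent probabilities `p_max`/`p_min` is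
`ε`-CI-keeping, i.e. the cross-multiplied inequality
`exp ε * (1 - p_max) * ((d-1) * p_min + 1) ≥ (1 - p_min) * ((d-1) * p_max + 1)`
holds. -/
theorem stmt8 (ε d pmin pmax X Y : ℝ) (hε : 0 ≤ ε) (hd : 1 ≤ d)
    (h0 : 0 ≤ pmin) (h1 : pmin ≤ pmax) (h2 : pmax ≤ 1)
    (hX : X = Real.exp ε * pmin * (1 - pmax) - pmax * (1 - pmin))
    (hY : Y = (Real.exp ε - 1) * (1 - pmax) * (pmin - 1))
    (hcase : 0 ≤ X ∨ (X < 0 ∧ d ≤ Y / X)) :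
    Real.exp ε * (1 - pmax) * ((d - 1) * pmin + 1) ≥
      (1 - pmin) * ((d - 1) * pmax + 1) := by
  have key : Real.exp ε * (1 - pmax) * ((d - 1) * pmin + 1) -
      (1 - pmin) * ((d - 1) * pmax + 1) = d * X - Y := by
    rw [hX, hY]; ring
  have h : Y ≤ d * X := by
    rcases hcase with h | ⟨hneg, hle⟩
    · have hY0 : Y ≤ 0 := by
        rw [hY]
        exact mul_nonpos_of_nonneg_of_nonpos
          (mul_nonneg (sub_nonneg.2 (Real.one_le_exp hε)) (sub_nonneg.2 h2)) (by linarith)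
      exact hY0.trans (mul_nonneg (by linarith) h)
    · exact (le_div_iff_of_neg hneg).1 hle
  linarith
end

section
/- Assume the sequence R_1, …, R_m is disjoint-superset. Then for every i with 1 ≤ i ≤ m and every spent coin permutation σ for the first i−1 ring signatures, exactly ns_i of the coins σ(1), …, σ(i−1) lie in R_i; consequently, the number of spent coin permutations for the first i ring signatures extending σ is exactly d_i = |R_i| − ns_i. -/
open scoped Classical

theorem DisjointSuperset.mem_iff_subset {C : Type*} [Fintype C] [DecidableEq C]
    {R : ℕ → Finset C} {m n : ℕ} (hds : DisjointSuperset R m) (hn : n + 1 ≤ m)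
    {σ : Fin n → C} (hσ : σ ∈ perms R n) (j : Fin n) :
    σ j ∈ R (n + 1) ↔ R (j.1 + 1) ⊆ R (n + 1) := by
  have hj := (mem_perms.1 hσ).2 j
  refine ⟨fun h => ?_, fun h => h hj⟩
  rcases hds (n + 1) (j.1 + 1) (by omega) (by omega) hn with hd | hs
  · exact absurd hj (Finset.disjoint_left.1 hd h)
  · exact hs

theorem DisjointSuperset.card_spent {C : Type*} [Fintype C] [DecidableEq C]
    {R : ℕ → Finset C} {m n : ℕ} (hds : DisjointSuperset R m) (hn : n + 1 ≤ m)
    {σ : Fin n → C} (hσ : σ ∈ perms R n) :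
    (Finset.univ.filter fun j : Fin n => σ j ∈ R (n + 1)).card = nsub R (n + 1) := by
  refine Finset.card_bij (fun j _ => j.1 + 1) ?_ ?_ ?_
  · intro j hj
    have hsub := (hds.mem_iff_subset hn hσ j).1 (Finset.mem_filter.1 hj).2
    exact Finset.mem_filter.2 ⟨Finset.mem_Ico.2 ⟨by omega, by omega⟩, hsub⟩
  · intro a _ b _ hab
    exact Fin.ext (by omega)
  · intro b hb
    obtain ⟨hb, hsub⟩ := Finset.mem_filter.1 hb
    obtain ⟨hb1, hbn⟩ := Finset.mem_Ico.1 hb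
    obtain ⟨b, rfl⟩ := Nat.exists_eq_add_of_le' hb1
    have hlt : b < n := by omega
    refine ⟨⟨b, hlt⟩, Finset.mem_filter.2 ⟨Finset.mem_univ _, ?_⟩, rfl⟩
    exact (hds.mem_iff_subset hn hσ ⟨b, hlt⟩).2 hsub

theorem snoc_mem_perms_iff {C : Type*} [Fintype C] [DecidableEq C]
    {R : ℕ → Finset C} {n : ℕ} {σ : Fin n → C} (hσ : σ ∈ perms R n) (c : C) :
    (Fin.snoc σ c : Fin (n + 1) → C) ∈ perms R (n + 1) ↔
      c ∈ R (n + 1) ∧ c ∉ Set.range σ := by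
  obtain ⟨hinj, hmem⟩ := mem_perms.1 hσ
  simp [mem_perms, Fin.snoc_injective_iff, Fin.forall_fin_succ', hinj, hmem, and_comm]

theorem card_extensions {C : Type*} [Fintype C] [DecidableEq C]
    {R : ℕ → Finset C} {n : ℕ} {σ : Fin n → C} (hσ : σ ∈ perms R n) :
    ((perms R (n + 1)).filter fun τ => ∀ j : Fin n, τ j.castSucc = σ j).card =
      (R (n + 1)).card - (Finset.univ.filter fun j : Fin n => σ j ∈ R (n + 1)).card := by
  have hspent : (Finset.univ.filter fun j : Fin n => σ j ∈ R (n + 1)).card =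
      (Finset.univ.image σ ∩ R (n + 1)).card := by
    rw [← Finset.filter_mem_eq_inter, Finset.filter_image,
      Finset.card_image_of_injective _ (mem_perms.1 hσ).1]
  rw [hspent, ← Finset.card_sdiff]
  symm
  refine Finset.card_bij (fun c _ => (Fin.snoc σ c : Fin (n + 1) → C)) ?_ ?_ ?_
  · intro c hc
    refine Finset.mem_filter.2 ⟨(snoc_mem_perms_iff hσ c).2 ?_, fun j => Fin.snoc_castSucc ..⟩
    simpa using hc
  · intro a _ b _ hab
    simpa using congrFun hab (Fin.last n)
  · intro τ hτ
    obtain ⟨hτ, hext⟩ := Finset.mem_filter.1 hτ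
    have heq : (Fin.snoc σ (τ (Fin.last n)) : Fin (n + 1) → C) = τ := by
      funext j
      refine Fin.lastCases ?_ (fun j => ?_) j
      · simp
      · simp [hext]
    rw [← heq, snoc_mem_perms_iff hσ] at hτ
    exact ⟨τ (Fin.last n), by simpa using hτ, heq⟩

theorem stmt10 {C : Type*} [Fintype C] [DecidableEq C]
    (R : ℕ → Finset C) (m : ℕ)
    (hne : ∀ i, 1 ≤ i → i ≤ m → (R i).Nonempty)
    (hds : DisjointSuperset R m) :
    ∀ i, 1 ≤ i → i ≤ m → ∀ σ ∈ perms R (i - 1),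
      (Finset.univ.filter fun j : Fin (i - 1) => σ j ∈ R i).card = nsub R i ∧
      ((perms R i).filter fun τ =>
          ∀ j : Fin (i - 1), τ (Fin.castLE (Nat.sub_le i 1) j) = σ j).card = deg R i := by
  intro i hi him
  obtain ⟨n, rfl⟩ := Nat.exists_eq_add_of_le' hi
  intro σ hσ
  have hspent := hds.card_spent him hσ
  refine ⟨hspent, ?_⟩
  rw [deg, ← hspent]
  exact card_extensions hσ
end

section
/- Let R_1, …, R_m be a sequence of ring signatures such that R_m = {c_1, c_2} consists of two distinct coins with c_1 ∉ R_j and c_2 ∉ R_j for all j < m. Then the number of spent coin permutations for the first m ring signatures with σ(m) = c_1 equals the number with σ(m) = c_2, and both equal N_{m−1}; in particular, if N_{m−1} > 0 then Pr_m(c_1, r_m) = Pr_m(c_2, r_m) and Pr_m(r_m | c_1) = Pr_m(r_m | c_2) = 1. -/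
open scoped Classical

/-- If `c` is a fresh coin of the last ring, the permutations spending `c` there correspond to
the permutations for the earlier rings. -/
theorem card_perms_filter_last_eq {C : Type*} [Fintype C] [DecidableEq C]
    (R : ℕ → Finset C) (n : ℕ) (c : C) (hc : c ∈ R (n + 1))
    (hfresh : ∀ j, 1 ≤ j → j < n + 1 → c ∉ R j) :
    ((perms R (n + 1)).filter fun σ => σ (Fin.last n) = c).card = numPerms R n := by
  symm
  refine Finset.card_bij (fun σ _ => (Fin.snoc σ c : Fin (n + 1) → C)) ?_ ?_ ?_
  · intro σ hσ
    rw [mem_perms] at hσ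
    simp only [Finset.mem_filter, mem_perms, Fin.snoc_last, and_true]
    refine ⟨Fin.snoc_injective_iff.2 ⟨hσ.1, ?_⟩, fun j => ?_⟩
    · rintro ⟨j, rfl⟩
      exact hfresh (j.1 + 1) (by omega) (by omega) (hσ.2 j)
    · induction j using Fin.lastCases with
      | last => simpa using hc
      | cast j => simpa using hσ.2 j
  · intro σ _ τ _ h
    exact (Fin.snoc_inj.1 h).1
  · intro σ hmem
    obtain ⟨hσ, rfl⟩ := Finset.mem_filter.1 hmem
    rw [mem_perms] at hσ
    refine ⟨Fin.init σ, mem_perms.2 ⟨?_, fun j => hσ.2 j.castSucc⟩, Fin.snoc_init_self σ⟩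
    exact hσ.1.comp (Fin.castSucc_injective n)

/-- A fresh coin of the last ring can only be spent there. -/
theorem exists_eq_iff_last_eq {C : Type*} [Fintype C] [DecidableEq C]
    {R : ℕ → Finset C} {n : ℕ} {c : C} (hfresh : ∀ j, 1 ≤ j → j < n + 1 → c ∉ R j)
    {σ : Fin (n + 1) → C} (hσ : σ ∈ perms R (n + 1)) :
    (∃ j, σ j = c) ↔ σ (Fin.last n) = c := by
  refine ⟨?_, fun h => ⟨_, h⟩⟩
  rintro ⟨j, rfl⟩
  induction j using Fin.lastCases with
  | last => rfl
  | cast j =>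
    exact absurd ((mem_perms.1 hσ).2 j.castSucc)
      (hfresh (j.1 + 1) (by omega) (by omega))

theorem card_perms_filter_spentIn {C : Type*} [Fintype C] [DecidableEq C]
    (R : ℕ → Finset C) (n : ℕ) (c : C) (hc : c ∈ R (n + 1))
    (hfresh : ∀ j, 1 ≤ j → j < n + 1 → c ∉ R j) :
    ((perms R (n + 1)).filter fun σ =>
      ∃ h : n + 1 - 1 < n + 1, σ ⟨n + 1 - 1, h⟩ = c).card = numPerms R n := by
  rw [← card_perms_filter_last_eq R n c hc hfresh]
  congr 1
  ext σ
  simp [Fin.last]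

theorem prCond_last_eq_one {C : Type*} [Fintype C] [DecidableEq C]
    (R : ℕ → Finset C) (n : ℕ) (c : C) (hc : c ∈ R (n + 1))
    (hfresh : ∀ j, 1 ≤ j → j < n + 1 → c ∉ R j) (hpos : 0 < numPerms R n) :
    prCond R (n + 1) (n + 1) c = 1 := by
  have hspent : ((perms R (n + 1)).filter fun σ => ∃ j, σ j = c).card = numPerms R n := by
    rw [← card_perms_filter_last_eq R n c hc hfresh]
    congr 1
    ext σ
    simp only [Finset.mem_filter]
    exact and_congr_right fun hσ => exists_eq_iff_last_eq hfresh hσ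
  have htotal : 0 < numPerms R (n + 1) := by
    refine (hpos.trans_eq hspent.symm).trans_le ?_
    exact Finset.card_filter_le _ _
  rw [prCond, prSpentIn, prSpent, card_perms_filter_spentIn R n c hc hfresh, hspent]
  exact div_self (by positivity)

theorem stmt15 {C : Type*} [Fintype C] [DecidableEq C]
    (R : ℕ → Finset C) (m : ℕ) (hm : 1 ≤ m)
    (hne : ∀ i, 1 ≤ i → i ≤ m → (R i).Nonempty)
    (c₁ c₂ : C) (hcc : c₁ ≠ c₂) (hRm : R m = {c₁, c₂})
    (hfresh : ∀ j, 1 ≤ j → j < m → c₁ ∉ R j ∧ c₂ ∉ R j) :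
    ((perms R m).filter fun σ => ∃ h : m - 1 < m, σ ⟨m - 1, h⟩ = c₁).card
        = numPerms R (m - 1) ∧
    ((perms R m).filter fun σ => ∃ h : m - 1 < m, σ ⟨m - 1, h⟩ = c₂).card
        = numPerms R (m - 1) ∧
    (0 < numPerms R (m - 1) →
      prSpentIn R m m c₁ = prSpentIn R m m c₂ ∧
      prCond R m m c₁ = 1 ∧ prCond R m m c₂ = 1) := by
  obtain ⟨n, rfl⟩ : ∃ n, m = n + 1 := ⟨m - 1, by omega⟩
  have hc₁ : c₁ ∈ R (n + 1) := by simp [hRm]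
  have hc₂ : c₂ ∈ R (n + 1) := by simp [hRm]
  have hf₁ : ∀ j, 1 ≤ j → j < n + 1 → c₁ ∉ R j := fun j h h' => (hfresh j h h').1
  have hf₂ : ∀ j, 1 ≤ j → j < n + 1 → c₂ ∉ R j := fun j h h' => (hfresh j h h').2
  have h₁ := card_perms_filter_spentIn R n c₁ hc₁ hf₁
  have h₂ := card_perms_filter_spentIn R n c₂ hc₂ hf₂
  refine ⟨h₁, h₂, fun hpos => ⟨?_, prCond_last_eq_one R n c₁ hc₁ hf₁ hpos,
    prCond_last_eq_one R n c₂ hc₂ hf₂ hpos⟩⟩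
  rw [prSpentIn, prSpentIn, h₁, h₂]
end
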